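/- Let g > 0 and let f : ℝ → ℝ be a C⁴ function with f(t+1) = f(t) for all t. Then there exists α* ∈ ℝ such that for every rational α = p/q > α* (with p, q positive integers) there exist sequences (tₙ)ₙ∈ℤ and (wₙ)ₙ∈ℤ with t_{n+1} > tₙ, satisfying the bouncing-ball recursion tₙ = t_{n-1} + (2/g)·w_{n-1} − (2/g)·(f(tₙ) − f(t_{n-1}))/(tₙ − t_{n-1}) + (2/g)·f′(t_{n-1}) and wₙ = w_{n-1} − 2·(f(tₙ) − f(t_{n-1}))/(tₙ − t_{n-1}) + f′(tₙ) + f′(t_{n-1}) for all n, together with the periodicity conditions t_{n+q} = tₙ + p and w_{n+q} = wₙ for all n ∈ ℤ; this corresponds to a p-periodic bouncing motion with q bounces per period. -/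

import Mathlib

open Filter Topology

/-- The bouncing-ball recursion (equations (3) of the paper): `t` is the strictly
increasing sequence of impact times and `w` the sequence of post-impact relative
velocities, for gravity `g` and racket motion `f`. -/
def BouncingOrbit (g : ℝ) (f : ℝ → ℝ) (t w : ℤ → ℝ) : Prop :=
  (∀ n : ℤ, t n < t (n + 1)) ∧
  (∀ n : ℤ, t n = t (n - 1) + 2 / g * w (n - 1)
      - 2 / g * ((f (t n) - f (t (n - 1))) / (t n - t (n - 1)))
      + 2 / g * deriv f (t (n - 1))) ∧
  (∀ n : ℤ, w n = w (n - 1) - 2 * ((f (t n) - f (t (n - 1))) / (t n - t (n - 1)))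
      + deriv f (t n) + deriv f (t (n - 1)))

/-- The sequences with `x (n + q) = x n + p` all of whose gaps are at least `K`. -/
def gapConfigs (K : ℝ) (p q : ℕ) : Set (ℤ → ℝ) :=
  {x | (∀ n : ℤ, x (n + q) = x n + p) ∧ ∀ n : ℤ, K ≤ x (n + 1) - x n}

/-- The action of one period of a sequence, for the generating function `h`. -/
def periodAction (h : ℝ → ℝ → ℝ) (q : ℕ) (x : ℤ → ℝ) : ℝ :=
  ∑ k ∈ Finset.range q, h (x k) (x (k + 1))

theorem Int.forall_of_forall_lt_of_periodic {q : ℕ} (hq : 0 < q) {Q : ℤ → Prop}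
    (hQ : ∀ n : ℤ, Q (n + q) ↔ Q n) (h : ∀ k : ℕ, k < q → Q k) (n : ℤ) : Q n := by
  have key : ∀ (m r : ℤ), Q (r + m * q) ↔ Q r := by
    intro m r
    induction m using Int.induction_on with
    | zero => simp
    | succ i ih =>
      rw [← ih, ← hQ (r + i * q)]
      ring_nf
    | pred i ih =>
      rw [← ih, ← hQ (r + (-i - 1) * q)]
      ring_nf
  have hq' : (0 : ℤ) < q := by exact_mod_cast hq
  have h0 := Int.emod_nonneg n hq'.ne'
  have h1 := Int.emod_lt_of_pos n hq'
  have h2 := h (n % q).toNat (by omega)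
  rw [Int.toNat_of_nonneg h0, ← key (n / q)] at h2
  rwa [mul_comm, Int.emod_add_mul_ediv] at h2

theorem Finset.sum_range_int_succ_of_periodic {q : ℕ} {u : ℤ → ℝ}
    (hu : ∀ n : ℤ, u (n + q) = u n) :
    ∑ k ∈ Finset.range q, u (k + 1) = ∑ k ∈ Finset.range q, u k := by
  have h1 := Finset.sum_range_succ (fun k : ℕ => u k) q
  have h2 := Finset.sum_range_succ' (fun k : ℕ => u k) q
  have h3 := hu 0
  push_cast at h1 h2
  rw [zero_add] at h3
  linarith

section Configs

variable {K : ℝ} {p q : ℕ} {x y : ℤ → ℝ}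

theorem gapConfigs_add_mul (hx : x ∈ gapConfigs K p q) (n m : ℤ) :
    x (n + m * q) = x n + m * p := by
  induction m using Int.induction_on with
  | zero => simp
  | succ i ih =>
    have := hx.1 (n + i * q)
    rw [ih] at this
    push_cast
    rw [show n + ((i : ℤ) + 1) * q = n + i * q + q by ring, this]
    push_cast
    ring
  | pred i ih =>
    have := hx.1 (n + (-i - 1) * q)
    rw [show n + (-(i : ℤ) - 1) * q + q = n + -i * q by ring, ih] at this
    push_cast at this ⊢
    linarith

theorem gapConfigs_dist_le (hK : 0 < K) (hq : 0 < q) (hx : x ∈ gapConfigs K p q) (n : ℤ) :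
    (p : ℝ) / q * n - p + x 0 ≤ x n ∧ x n ≤ (p : ℝ) / q * n + p + x 0 := by
  have hmono : Monotone x := monotone_int_of_le_succ fun n => by linarith [hx.2 n]
  have hq' : (0 : ℤ) < q := by exact_mod_cast hq
  have hqr : (0 : ℝ) < q := by exact_mod_cast hq
  have h0 := Int.emod_nonneg n hq'.ne'
  have h1 := Int.emod_lt_of_pos n hq'
  have h2 := Int.emod_add_mul_ediv n q
  have l1 := hmono (show 0 + n / q * q ≤ n by linarith)
  have l2 := hmono (show n ≤ 0 + (n / q + 1) * q by linarith)
  rw [gapConfigs_add_mul hx] at l1 l2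
  have e : (p : ℝ) / q * n = p / q * (n % q : ℤ) + (n / q : ℤ) * p := by
    have : (n : ℝ) = (n % q : ℤ) + q * (n / q : ℤ) := by exact_mod_cast h2.symm
    rw [this]
    field_simp
  have b0 : (0 : ℝ) ≤ p / q * (n % q : ℤ) := by
    have : (0 : ℝ) ≤ (n % q : ℤ) := by exact_mod_cast h0
    positivity
  have b1 : (p : ℝ) / q * (n % q : ℤ) ≤ p := by
    have : ((n % q : ℤ) : ℝ) ≤ q := by exact_mod_cast h1.le
    calc (p : ℝ) / q * (n % q : ℤ) ≤ p / q * q := by gcongr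
      _ = p := by field_simp
  push_cast at l2
  constructor <;> linarith

theorem gapConfigs_shift (hx : x ∈ gapConfigs K p q) (a : ℤ) (b : ℝ) :
    (fun n => x (n + a) + b) ∈ gapConfigs K p q := by
  refine ⟨fun n => ?_, fun n => ?_⟩
  · have := hx.1 (n + a)
    rw [show n + a + (q : ℤ) = n + q + a by ring] at this
    linarith
  · have := hx.2 (n + a)
    rw [show n + a + 1 = n + 1 + a by ring] at this
    linarith

theorem gapConfigs_inf (hx : x ∈ gapConfigs K p q) (hy : y ∈ gapConfigs K p q) :
    x ⊓ y ∈ gapConfigs K p q := by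
  refine ⟨fun n => ?_, fun n => ?_⟩
  · simp only [Pi.inf_apply, hx.1, hy.1]
    exact min_add_add_right _ _ _
  · have h1 := hx.2 n
    have h2 := hy.2 n
    simp only [Pi.inf_apply]
    rcases min_cases (x (n + 1)) (y (n + 1)) with h | h <;>
      rcases min_cases (x n) (y n) with h' | h' <;> linarith

theorem gapConfigs_sup (hx : x ∈ gapConfigs K p q) (hy : y ∈ gapConfigs K p q) :
    x ⊔ y ∈ gapConfigs K p q := by
  refine ⟨fun n => ?_, fun n => ?_⟩
  · simp only [Pi.sup_apply, hx.1, hy.1]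
    exact max_add_add_right _ _ _
  · have h1 := hx.2 n
    have h2 := hy.2 n
    simp only [Pi.sup_apply]
    rcases max_cases (x (n + 1)) (y (n + 1)) with h | h <;>
      rcases max_cases (x n) (y n) with h' | h' <;> linarith

theorem isClosed_gapConfigs : IsClosed (gapConfigs K p q) := by
  simp only [gapConfigs, Set.ofPred_and, Set.ofPred_forall]
  exact (isClosed_iInter fun n => isClosed_eq (by fun_prop) (by fun_prop)).inter
    (isClosed_iInter fun n => isClosed_le (by fun_prop) (by fun_prop))

variable {h : ℝ → ℝ → ℝ}

theorem periodAction_add_const (hdiag : ∀ (m : ℤ) (a b : ℝ), h (a + m) (b + m) = h a b)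
    (x : ℤ → ℝ) (m : ℤ) : periodAction h q (fun n => x n + m) = periodAction h q x := by
  simp only [periodAction, hdiag]

theorem periodAction_succ (hdiag : ∀ (m : ℤ) (a b : ℝ), h (a + m) (b + m) = h a b)
    (hx : x ∈ gapConfigs K p q) :
    periodAction h q (fun n => x (n + 1)) = periodAction h q x := by
  refine Finset.sum_range_int_succ_of_periodic (u := fun n => h (x n) (x (n + 1))) fun n => ?_
  have := hdiag p (x n) (x (n + 1))
  simp only [Int.cast_natCast] at this
  rw [← this, ← hx.1, ← hx.1, add_right_comm]

theorem continuousOn_periodAction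
    (hcont : ContinuousOn (fun a : ℝ × ℝ => h a.1 a.2) {a | K ≤ a.2 - a.1}) :
    ContinuousOn (periodAction h q) (gapConfigs K p q) := by
  refine continuousOn_finsetSum _ fun k _ => ?_
  exact hcont.comp (f := fun x : ℤ → ℝ => (x k, x (k + 1))) (by fun_prop) fun x hx => hx.2 k

theorem periodAction_inf_add_sup
    (hsub : ∀ a c d b : ℝ, a ≤ c → d ≤ b → K ≤ d - c → h a d + h c b ≤ h a b + h c d)
    (hx : x ∈ gapConfigs K p q) (hy : y ∈ gapConfigs K p q) :
    periodAction h q (x ⊓ y) + periodAction h q (x ⊔ y) ≤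
      periodAction h q x + periodAction h q y := by
  simp only [periodAction, ← Finset.sum_add_distrib]
  refine Finset.sum_le_sum fun k _ => ?_
  have h1 := hx.2 k
  have h2 := hy.2 k
  simp only [Pi.inf_apply, Pi.sup_apply]
  rcases le_total (x k) (y k) with i | i <;>
    rcases le_total (x (k + 1)) (y (k + 1)) with j | j <;> simp only [i, j, inf_of_le_left,
      inf_of_le_right, sup_of_le_left, sup_of_le_right]
  · exact le_rfl
  · exact hsub _ _ _ _ i j h2
  · linarith [hsub _ _ _ _ i j h1]
  · linarith

/-- A twist generating function has a periodic minimizer, and the smallest minimizer above the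
line of slope `p / q` has all its gaps at least `⌊p / q⌋`. -/
theorem exists_minimizer_floor_le_gap (hK : 0 < K) (hq : 0 < q) (hKpq : K ≤ (p : ℝ) / q)
    (hdiag : ∀ (m : ℤ) (a b : ℝ), h (a + m) (b + m) = h a b)
    (hcont : ContinuousOn (fun a : ℝ × ℝ => h a.1 a.2) {a | K ≤ a.2 - a.1})
    (hsub : ∀ a c d b : ℝ, a ≤ c → d ≤ b → K ≤ d - c → h a d + h c b ≤ h a b + h c d) :
    ∃ z ∈ gapConfigs K p q, (∀ y ∈ gapConfigs K p q, periodAction h q z ≤ periodAction h q y) ∧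
      ∀ n : ℤ, (⌊(p : ℝ) / q⌋ : ℝ) ≤ z (n + 1) - z n := by
  set α : ℝ := (p : ℝ) / q with hα
  have hqr : (0 : ℝ) < q := by exact_mod_cast hq
  obtain ⟨u, ⟨huP, hu0⟩, humin⟩ : ∃ u ∈ gapConfigs K p q ∩ {x | x 0 ∈ Set.Icc (p : ℝ) (p + 1)},
      ∀ y ∈ gapConfigs K p q ∩ {x | x 0 ∈ Set.Icc (p : ℝ) (p + 1)},
        periodAction h q u ≤ periodAction h q y := by
    have hcomp : IsCompact (gapConfigs K p q ∩ {x | x 0 ∈ Set.Icc (p : ℝ) (p + 1)}) := by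
      refine (isCompact_univ_pi fun n : ℤ => isCompact_Icc (a := α * n)
        (b := α * n + 2 * p + 1)).of_isClosed_subset
        (isClosed_gapConfigs.inter (isClosed_Icc.preimage (continuous_apply 0))) ?_
      intro x hx' n _
      obtain ⟨hx, hx0⟩ := hx'
      have h1 := gapConfigs_dist_le hK hq hx n
      have h2 := hx0.1
      have h3 := hx0.2
      constructor <;> linarith [h1.1, h1.2]
    have hne : (fun n : ℤ => α * n + p) ∈
        gapConfigs K p q ∩ {x | x 0 ∈ Set.Icc (p : ℝ) (p + 1)} := by
      refine ⟨⟨fun n => ?_, fun n => ?_⟩, by simp⟩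
      · push_cast
        rw [hα]
        field_simp
      · push_cast
        linarith
    obtain ⟨u, hu, hmin⟩ := hcomp.exists_isMinOn ⟨_, hne⟩
      ((continuousOn_periodAction hcont).mono Set.inter_subset_left)
    exact ⟨u, hu, isMinOn_iff.1 hmin⟩
  have hglob : ∀ y ∈ gapConfigs K p q, periodAction h q u ≤ periodAction h q y := by
    intro y hy
    rw [← periodAction_add_const hdiag y (p - ⌊y 0⌋)]
    refine humin _ ⟨by simpa using gapConfigs_shift hy 0 ((p - ⌊y 0⌋ : ℤ) : ℝ), ?_⟩
    have h1 := Int.floor_le (y 0)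
    have h2 := Int.lt_floor_add_one (y 0)
    simp only [Set.mem_ofPred_eq, Set.mem_Icc]
    push_cast
    constructor <;> linarith
  let A : Set (ℤ → ℝ) :=
    {x | x ∈ gapConfigs K p q ∧ periodAction h q x ≤ periodAction h q u ∧ ∀ n : ℤ, α * n ≤ x n}
  have huA : u ∈ A := ⟨huP, le_rfl, fun n => by
    have := (gapConfigs_dist_le hK hq huP n).1
    linarith [hu0.1]⟩
  have hAclosed : IsClosed A := by
    have h1 : IsClosed (gapConfigs K p q ∩ periodAction h q ⁻¹' Set.Iic (periodAction h q u)) :=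
      (continuousOn_periodAction hcont).preimage_isClosed_of_isClosed isClosed_gapConfigs
        isClosed_Iic
    have h2 : IsClosed {x : ℤ → ℝ | ∀ n : ℤ, α * n ≤ x n} := by
      simp only [Set.ofPred_forall]
      exact isClosed_iInter fun n => isClosed_le continuous_const (continuous_apply n)
    convert h1.inter h2 using 1
    ext x
    exact and_assoc.symm
  obtain ⟨z, ⟨hzA, hzu⟩, hzmin⟩ : ∃ z ∈ A ∩ Set.Iic u, ∀ y ∈ A ∩ Set.Iic u,
      ∑ k ∈ Finset.range q, z k ≤ ∑ k ∈ Finset.range q, y k := by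
    have hcomp : IsCompact (A ∩ Set.Iic u) := by
      refine (isCompact_univ_pi fun n : ℤ => isCompact_Icc (a := α * n)
        (b := u n)).of_isClosed_subset (hAclosed.inter isClosed_Iic) ?_
      intro x hx n _
      exact ⟨hx.1.2.2 n, hx.2 n⟩
    obtain ⟨z, hz, hmin⟩ := hcomp.exists_isMinOn ⟨u, huA, Set.mem_Iic.2 le_rfl⟩
      (f := fun y : ℤ → ℝ => ∑ k ∈ Finset.range q, y k) (by fun_prop)
    exact ⟨z, hz, isMinOn_iff.1 hmin⟩
  have hzle : ∀ y ∈ A, z ≤ y := by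
    intro y hy
    have hinf := gapConfigs_inf hzA.1 hy.1
    have hmem : z ⊓ y ∈ A := by
      refine ⟨hinf, ?_, fun n => le_min (hzA.2.2 n) (hy.2.2 n)⟩
      linarith [periodAction_inf_add_sup hsub hzA.1 hy.1, hglob _ (gapConfigs_sup hzA.1 hy.1),
        hzA.2.1, hy.2.1]
    have hs := hzmin _ ⟨hmem, le_trans (b := z) inf_le_left hzu⟩
    have heq := (Finset.sum_eq_sum_iff_of_le (s := Finset.range q)
      (f := fun k : ℕ => (z ⊓ y) k) (g := fun k : ℕ => z k)
      fun k _ => min_le_left _ _).1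
      (le_antisymm (Finset.sum_le_sum fun k _ => min_le_left _ _) hs)
    refine Int.forall_of_forall_lt_of_periodic hq (Q := fun n => z n ≤ y n) (fun n => ?_)
      fun k hk => ?_
    · rw [hzA.1.1, hy.1.1, add_le_add_iff_right]
    · exact min_eq_left_iff.1 (heq k (Finset.mem_range.2 hk))
  refine ⟨z, hzA.1, fun y hy => hzA.2.1.trans (hglob y hy), fun n => ?_⟩
  have hshift := gapConfigs_shift hzA.1 1 ((-⌊α⌋ : ℤ) : ℝ)
  have hτ : (fun n => z (n + 1) + ((-⌊α⌋ : ℤ) : ℝ)) ∈ A := by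
    refine ⟨hshift, ?_, fun n => ?_⟩
    · rw [periodAction_add_const hdiag (fun n => z (n + 1)), periodAction_succ hdiag hzA.1]
      exact hzA.2.1
    · have h1 := hzA.2.2 (n + 1)
      have h2 := Int.floor_le α
      push_cast at h1 ⊢
      linarith
  have := hzle _ hτ n
  push_cast at this
  linarith

/-- Euler–Lagrange equation for an action-minimizing sequence whose gaps are not critical. -/
theorem euler_lagrange_of_minimizer (hq : 0 < q) {h₁ h₂ : ℝ → ℝ → ℝ}
    (hdiag₁ : ∀ (m : ℤ) (a b : ℝ), h₁ (a + m) (b + m) = h₁ a b)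
    (hdiag₂ : ∀ (m : ℤ) (a b : ℝ), h₂ (a + m) (b + m) = h₂ a b)
    (hderiv : ∀ (a b u v : ℝ), K < b - a →
      HasDerivAt (fun s => h (a + s * u) (b + s * v)) (h₁ a b * u + h₂ a b * v) 0)
    (hx : x ∈ gapConfigs K p q) (hgap : ∀ n : ℤ, K < x (n + 1) - x n)
    (hmin : ∀ y ∈ gapConfigs K p q, periodAction h q x ≤ periodAction h q y) (n : ℤ) :
    h₁ (x (n + 1)) (x (n + 1 + 1)) + h₂ (x n) (x (n + 1)) = 0 := by
  set E : ℤ → ℝ := fun n => h₁ (x n) (x (n + 1)) + h₂ (x (n - 1)) (x n) with hE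
  have per₁ : ∀ n : ℤ, h₁ (x (n + q)) (x (n + q + 1)) = h₁ (x n) (x (n + 1)) := fun n => by
    have := hdiag₁ p (x n) (x (n + 1))
    rw [Int.cast_natCast, ← hx.1, ← hx.1] at this
    rw [← this, add_right_comm]
  have per₂ : ∀ n : ℤ, h₂ (x (n + q)) (x (n + q + 1)) = h₂ (x n) (x (n + 1)) := fun n => by
    have := hdiag₂ p (x n) (x (n + 1))
    rw [Int.cast_natCast, ← hx.1, ← hx.1] at this
    rw [← this, add_right_comm]
  have perE : ∀ n : ℤ, E (n + q) = E n := fun n => by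
    have := per₂ (n - 1)
    rw [sub_add_cancel, show n - 1 + (q : ℤ) + 1 = n + q by ring,
      show n - 1 + (q : ℤ) = n + q - 1 by ring] at this
    simp only [hE, per₁, this]
  have hd : HasDerivAt (fun s => periodAction h q (fun n => x n + s * E n))
      (∑ k ∈ Finset.range q, (h₁ (x k) (x (k + 1)) * E k + h₂ (x k) (x (k + 1)) * E (k + 1))) 0 :=
    HasDerivAt.fun_sum fun k _ => hderiv _ _ _ _ (hgap k)
  have hsum : ∑ k ∈ Finset.range q,
      (h₁ (x k) (x (k + 1)) * E k + h₂ (x k) (x (k + 1)) * E (k + 1)) =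
      ∑ k ∈ Finset.range q, E k ^ 2 := by
    have := Finset.sum_range_int_succ_of_periodic (q := q)
      (u := fun n : ℤ => h₂ (x (n - 1)) (x n) * E n) fun n => by
        have := per₂ (n - 1)
        rw [sub_add_cancel, show n - 1 + (q : ℤ) + 1 = n + q by ring,
          show n - 1 + (q : ℤ) = n + q - 1 by ring] at this
        rw [this, perE]
    simp only [add_sub_cancel_right] at this
    rw [Finset.sum_add_distrib, this, ← Finset.sum_add_distrib]
    refine Finset.sum_congr rfl fun k _ => ?_
    simp only [hE]
    ring
  have hloc : IsLocalMin (fun s => periodAction h q (fun n => x n + s * E n)) 0 := by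
    have hev : ∀ᶠ s : ℝ in 𝓝 0, ∀ k ∈ Finset.range q,
        K < (x ((k : ℤ) + 1) + s * E (k + 1)) - (x k + s * E k) := by
      refine (Finset.range q).eventually_all.2 fun k _ => ?_
      have hc : Continuous fun s : ℝ =>
          (x ((k : ℤ) + 1) + s * E (k + 1)) - (x k + s * E k) := by fun_prop
      refine hc.continuousAt.eventually_const_lt ?_
      simpa using hgap k
    filter_upwards [hev] with s hs
    simp only [zero_mul, add_zero]
    refine hmin _ ⟨fun n => ?_, ?_⟩
    · simp only [hx.1, perE]
      ring
    · refine Int.forall_of_forall_lt_of_periodic hq (fun n => ?_)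
        fun k hk => (hs k (Finset.mem_range.2 hk)).le
      simp only [add_right_comm n (q : ℤ) 1, hx.1, perE]
      ring_nf
  have hzero := hloc.hasDerivAt_eq_zero hd
  rw [hsum, Finset.sum_eq_zero_iff_of_nonneg fun k _ => sq_nonneg _] at hzero
  have hE0 := Int.forall_of_forall_lt_of_periodic hq (Q := fun n => E n = 0)
    (fun n => by rw [perE]) (fun k hk => pow_eq_zero_iff two_ne_zero |>.1
      (hzero k (Finset.mem_range.2 hk))) (n + 1)
  simpa [hE] using hE0

end Configs

section Bounce

/-- Relative velocity just after the impact at time `x`, if the next impact is at time `y`. -/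
noncomputable def launchSpeed (g : ℝ) (f : ℝ → ℝ) (x y : ℝ) : ℝ :=
  g / 2 * (y - x) + (f y - f x) / (y - x) - deriv f x

/-- Relative speed just before the impact at time `y`, if the previous impact is at time `x`. -/
noncomputable def landingSpeed (g : ℝ) (f : ℝ → ℝ) (x y : ℝ) : ℝ :=
  g / 2 * (y - x) - (f y - f x) / (y - x) + deriv f y

/-- Minus the Lagrangian action of the free flight between impacts at times `x` and `y`. -/
noncomputable def flightAction (g : ℝ) (f : ℝ → ℝ) (x y : ℝ) : ℝ :=
  g ^ 2 * (y - x) ^ 3 / 24 + g * (y - x) * (f x + f y) / 2 - (f y - f x) ^ 2 / (2 * (y - x))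

/-- The partial derivative of `flightAction` in its first variable. -/
noncomputable def flightActionFst (g : ℝ) (f : ℝ → ℝ) (x y : ℝ) : ℝ :=
  -(launchSpeed g f x y ^ 2 / 2 - deriv f x ^ 2 / 2 + g * f x)

/-- The partial derivative of `flightAction` in its second variable. -/
noncomputable def flightActionSnd (g : ℝ) (f : ℝ → ℝ) (x y : ℝ) : ℝ :=
  landingSpeed g f x y ^ 2 / 2 - deriv f y ^ 2 / 2 + g * f y

variable {g : ℝ} {f : ℝ → ℝ}

theorem HasDerivAt.flightAction (hf : Differentiable ℝ f) {X Y : ℝ → ℝ} {X' Y' s : ℝ}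
    (hX : HasDerivAt X X' s) (hY : HasDerivAt Y Y' s) (hlt : X s < Y s) :
    HasDerivAt (fun s => flightAction g f (X s) (Y s))
      (flightActionFst g f (X s) (Y s) * X' + flightActionSnd g f (X s) (Y s) * Y') s := by
  have hT : Y s - X s ≠ 0 := (sub_pos.2 hlt).ne'
  have hfX := (hf (X s)).hasDerivAt.comp s hX
  have hfY := (hf (Y s)).hasDerivAt.comp s hY
  have hYX := hY.sub hX
  have h1 := ((hYX.pow 3).const_mul (g ^ 2)).div_const 24
  have h2 := ((hYX.const_mul g).mul (hfX.add hfY)).div_const 2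
  have h3 := ((hfY.sub hfX).pow 2).div (hYX.const_mul 2) (mul_ne_zero two_ne_zero hT)
  refine ((h1.add h2).sub h3).congr_deriv ?_
  simp only [flightActionFst, flightActionSnd, launchSpeed, landingSpeed, Pi.sub_apply,
    Pi.add_apply, Pi.pow_apply, Function.comp_apply]
  field_simp
  ring

theorem abs_slope_le {L : ℝ} (hlip : ∀ x y, |f y - f x| ≤ L * |y - x|) {x y : ℝ} (hxy : x < y) :
    |(f y - f x) / (y - x)| ≤ L := by
  rw [abs_div, div_le_iff₀ (abs_pos.2 (sub_pos.2 hxy).ne')]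
  exact hlip x y

variable {L K : ℝ}

theorem launchSpeed_nonneg (hg : 0 < g) (hK : 0 < K) (hL : 4 * L ≤ g * K)
    (hd : ∀ x, |deriv f x| ≤ L) (hlip : ∀ x y, |f y - f x| ≤ L * |y - x|)
    {x y : ℝ} (hxy : K ≤ y - x) : 0 ≤ launchSpeed g f x y := by
  have h1 := abs_le.1 (abs_slope_le hlip (show x < y by linarith))
  have h2 := abs_le.1 (hd x)
  have h3 := mul_le_mul_of_nonneg_left hxy hg.le
  unfold launchSpeed
  linarith [h1.1, h2.2]

theorem landingSpeed_nonneg (hg : 0 < g) (hK : 0 < K) (hL : 4 * L ≤ g * K)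
    (hd : ∀ x, |deriv f x| ≤ L) (hlip : ∀ x y, |f y - f x| ≤ L * |y - x|)
    {x y : ℝ} (hxy : K ≤ y - x) : 0 ≤ landingSpeed g f x y := by
  have h1 := abs_le.1 (abs_slope_le hlip (show x < y by linarith))
  have h2 := abs_le.1 (hd y)
  have h3 := mul_le_mul_of_nonneg_left hxy hg.le
  unfold landingSpeed
  linarith [h1.2, h2.1]

theorem launchSpeed_le_launchSpeed (hg : 0 < g) (hK : 0 < K) (hL : 4 * L ≤ g * K)
    (hlip : ∀ x y, |f y - f x| ≤ L * |y - x|)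
    {x y y' : ℝ} (hxy : K ≤ y - x) (hyy' : y ≤ y') :
    launchSpeed g f x y ≤ launchSpeed g f x y' := by
  have h1 := abs_le.1 (abs_slope_le hlip (show x < y by linarith))
  have h2 := hlip y y'
  rw [abs_of_nonneg (sub_nonneg.2 hyy')] at h2
  have h2' := abs_le.1 h2
  unfold launchSpeed
  set D := (f y - f x) / (y - x) with hD
  set D' := (f y' - f x) / (y' - x) with hD'
  have hT : 0 < y - x := by linarith
  have hT' : 0 < y' - x := by linarith
  have e : D * (y - x) = f y - f x := div_mul_cancel₀ _ hT.ne'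
  have e' : D' * (y' - x) = f y' - f x := div_mul_cancel₀ _ hT'.ne'
  have hgT : 4 * L ≤ g * (y' - x) := hL.trans (by gcongr; linarith)
  have key : 0 ≤ (g / 2 * (y' - y) + (D' - D)) * (y' - x) := by
    have : (g / 2 * (y' - y) + (D' - D)) * (y' - x) =
        (y' - y) * (g * (y' - x) / 2) + (f y' - f y) - D * (y' - y) := by
      linear_combination e' - e
    rw [this]
    nlinarith [mul_le_mul_of_nonneg_left h1.2 (sub_nonneg.2 hyy'),
      mul_le_mul_of_nonneg_left hgT (sub_nonneg.2 hyy'), h2'.1]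
  linarith [nonneg_of_mul_nonneg_left key hT']

theorem flightAction_submodular (hf : Differentiable ℝ f) (hg : 0 < g) (hK : 0 < K)
    (hL : 4 * L ≤ g * K) (hd : ∀ x, |deriv f x| ≤ L) (hlip : ∀ x y, |f y - f x| ≤ L * |y - x|)
    (a c d b : ℝ) (hac : a ≤ c) (hdb : d ≤ b) (hcd : K ≤ d - c) :
    flightAction g f a d + flightAction g f c b ≤
      flightAction g f a b + flightAction g f c d := by
  have hderiv : ∀ x ∈ Set.Icc a c,
      HasDerivAt (fun x => flightAction g f x b - flightAction g f x d)
        (flightActionFst g f x b - flightActionFst g f x d) x := by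
    intro x hx
    have hb := HasDerivAt.flightAction (g := g) hf (hasDerivAt_id x) (hasDerivAt_const x b)
      (by linarith [hx.2, id_eq x])
    have hd := HasDerivAt.flightAction (g := g) hf (hasDerivAt_id x) (hasDerivAt_const x d)
      (by linarith [hx.2, id_eq x])
    simpa using hb.fun_sub hd
  have hanti : AntitoneOn (fun x => flightAction g f x b - flightAction g f x d)
      (Set.Icc a c) := by
    refine antitoneOn_of_hasDerivWithinAt_nonpos (convex_Icc a c)
      (fun x hx => (hderiv x hx).continuousAt.continuousWithinAt)
      (fun x hx => (hderiv x (interior_subset hx)).hasDerivWithinAt) fun x hx => ?_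
    have hx' := interior_subset hx
    have hxd : K ≤ d - x := by linarith [hx'.2]
    have h1 := launchSpeed_nonneg hg hK hL hd hlip hxd
    have h2 := launchSpeed_le_launchSpeed hg hK hL hlip hxd hdb
    have h3 := pow_le_pow_left₀ h1 h2 2
    unfold flightActionFst
    linarith
  have := hanti (Set.left_mem_Icc.2 hac) (Set.right_mem_Icc.2 hac) hac
  simp only at this
  linarith

theorem continuousOn_flightAction (hf : Continuous f) (hK : 0 < K) :
    ContinuousOn (fun a : ℝ × ℝ => flightAction g f a.1 a.2) {a | K ≤ a.2 - a.1} := by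
  unfold flightAction
  refine ContinuousOn.sub (by fun_prop) (ContinuousOn.div (by fun_prop) (by fun_prop) ?_)
  intro a ha
  have : 0 < a.2 - a.1 := hK.trans_le ha
  positivity

/-- A `C¹` periodic function is Lipschitz with a bounded derivative. -/
theorem exists_deriv_bound_of_periodic (hf : ContDiff ℝ 1 f) (hper : Function.Periodic f 1) :
    ∃ L : ℝ, 0 ≤ L ∧ (∀ x, |deriv f x| ≤ L) ∧ ∀ x y, |f y - f x| ≤ L * |y - x| := by
  have hc : Continuous (deriv f) := hf.continuous_deriv le_rfl
  have hp : Function.Periodic (deriv f) 1 := fun x => by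
    rw [← deriv_comp_add_const, hper.funext]
  obtain ⟨L, hL⟩ := isCompact_Icc.exists_bound_of_continuousOn (s := Set.Icc (0 : ℝ) 1)
    hc.continuousOn
  have hd : ∀ x, |deriv f x| ≤ L := fun x => by
    obtain ⟨y, hy, hxy⟩ := hp.exists_mem_Ico₀ one_pos x
    rw [hxy]
    exact hL y ⟨hy.1, hy.2.le⟩
  refine ⟨L, (abs_nonneg _).trans (hd 0), hd, fun x y => ?_⟩
  exact convex_univ.norm_image_sub_le_of_norm_deriv_le
    (fun x _ => hf.differentiable one_ne_zero x) (fun x _ => hd x) trivial trivial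

end Bounce

theorem periodic_bouncing_orbits
    (g : ℝ) (hg : 0 < g) (f : ℝ → ℝ) (hf : ContDiff ℝ 4 f)
    (hper : ∀ t : ℝ, f (t + 1) = f t) :
    ∃ αstar : ℝ, ∀ p q : ℕ, 0 < p → 0 < q → αstar < (p : ℝ) / (q : ℝ) →
      ∃ t w : ℤ → ℝ, BouncingOrbit g f t w ∧
        (∀ n : ℤ, t (n + (q : ℤ)) = t n + (p : ℝ)) ∧
        (∀ n : ℤ, w (n + (q : ℤ)) = w n) := by
  have hdiff : Differentiable ℝ f := hf.differentiable (by norm_num)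
  obtain ⟨L, hL0, hd, hlip⟩ := exists_deriv_bound_of_periodic (hf.of_le (by norm_num)) hper
  have hfm : ∀ (m : ℤ) (a : ℝ), f (a + m) = f a := fun m a => by
    simpa using (Function.Periodic.int_mul hper m) a
  have hdm : ∀ (m : ℤ) (a : ℝ), deriv f (a + m) = deriv f a := fun m a => by
    rw [← deriv_comp_add_const, funext (hfm m)]
  obtain ⟨K, hK, hLK⟩ : ∃ K : ℝ, 0 < K ∧ 4 * L ≤ g * K :=
    ⟨4 * L / g + 1, by positivity, by field_simp; linarith⟩
  refine ⟨K + 1, fun p q _ hq hpq => ?_⟩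
  obtain ⟨z, hz, hmin, hgap⟩ := exists_minimizer_floor_le_gap (p := p) hK hq (by linarith)
    (h := flightAction g f) (fun m a b => by simp only [flightAction, hfm, add_sub_add_right_eq_sub])
    (continuousOn_flightAction hdiff.continuous hK)
    (flightAction_submodular hdiff hg hK hLK hd hlip)
  have hgap' : ∀ n : ℤ, K < z (n + 1) - z n := fun n => by
    linarith [hgap n, Int.lt_floor_add_one ((p : ℝ) / q)]
  have hpos : ∀ n : ℤ, z n < z (n + 1) := fun n => by linarith [hgap' n]
  have hlaunch : ∀ (m : ℤ) (a b : ℝ), launchSpeed g f (a + m) (b + m) = launchSpeed g f a b :=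
    fun m a b => by simp only [launchSpeed, hfm, hdm, add_sub_add_right_eq_sub]
  have hland : ∀ (m : ℤ) (a b : ℝ), landingSpeed g f (a + m) (b + m) = landingSpeed g f a b :=
    fun m a b => by simp only [landingSpeed, hfm, hdm, add_sub_add_right_eq_sub]
  have hel := euler_lagrange_of_minimizer hq (h₁ := flightActionFst g f)
    (h₂ := flightActionSnd g f)
    (fun m a b => by simp only [flightActionFst, hlaunch, hfm, hdm])
    (fun m a b => by simp only [flightActionSnd, hland, hfm, hdm])
    (fun a b u v hab => by
      have hX : HasDerivAt (fun s : ℝ => a + s * u) u 0 := by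
        simpa using ((hasDerivAt_id (0 : ℝ)).mul_const u).const_add a
      have hY : HasDerivAt (fun s : ℝ => b + s * v) v 0 := by
        simpa using ((hasDerivAt_id (0 : ℝ)).mul_const v).const_add b
      simpa using HasDerivAt.flightAction (g := g) hdiff hX hY (by simp; linarith))
    hz hgap' hmin
  have hspeed : ∀ n : ℤ,
      launchSpeed g f (z (n + 1)) (z (n + 1 + 1)) = landingSpeed g f (z n) (z (n + 1)) := by
    intro n
    have h1 := hel n
    unfold flightActionFst flightActionSnd at h1
    refine (pow_left_inj₀ (launchSpeed_nonneg hg hK hLK hd hlip (hgap' _).le)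
      (landingSpeed_nonneg hg hK hLK hd hlip (hgap' n).le) two_ne_zero).1 (by linarith)
  refine ⟨z, fun n => launchSpeed g f (z n) (z (n + 1)), ⟨hpos, fun n => ?_, fun n => ?_⟩,
    hz.1, fun n => ?_⟩
  · obtain ⟨m, rfl⟩ : ∃ m, n = m + 1 := ⟨n - 1, by ring⟩
    simp only [add_sub_cancel_right, launchSpeed]
    have hne : z (m + 1) - z m ≠ 0 := (sub_pos.2 (hpos m)).ne'
    field_simp
    ring
  · obtain ⟨m, rfl⟩ : ∃ m, n = m + 1 := ⟨n - 1, by ring⟩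
    simp only [add_sub_cancel_right]
    rw [hspeed]
    simp only [landingSpeed, launchSpeed]
    ring
  · have := hlaunch p (z n) (z (n + 1))
    rw [Int.cast_natCast, ← hz.1, ← hz.1] at this
    simpa only [add_right_comm n (q : ℤ) 1] using this
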